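/- For every real λ > λ* and every ε > 0, there exists a finite simple graph G with chromatic number at most 3 such that λ₁(G) lies in the open interval (-λ - ε, -λ). -/

import Mathlib

open scoped Classical in
/-- The real adjacency matrix of a finite simple graph on `Fin n`. -/
noncomputable def adjMat {n : ℕ} (G : SimpleGraph (Fin n)) : Matrix (Fin n) (Fin n) ℝ :=
  Matrix.of fun u v => if G.Adj u v then 1 else 0

/-- The smallest eigenvalue of the real adjacency matrix of a finite simple graph. -/
noncomputable def lam1 {n : ℕ} (G : SimpleGraph (Fin n)) : ℝ :=
  sInf {t : ℝ | ∃ x : Fin n → ℝ, x ≠ 0 ∧ (adjMat G).mulVec x = t • x}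

open scoped Classical in
/-- The quadratic form `x ↦ xᵀ (t I + A_G) x`. -/
noncomputable def shiftedForm {V : Type*} [Fintype V] (G : SimpleGraph V) (t : ℝ) (x : V → ℝ) : ℝ :=
  t * ∑ v, x v ^ 2 + ∑ u, ∑ v, if G.Adj u v then x u * x v else 0

theorem shiftedForm_smul {V : Type*} [Fintype V] (G : SimpleGraph V) (t a : ℝ) (x : V → ℝ) :
    shiftedForm G t (a • x) = a ^ 2 * shiftedForm G t x := by
  simp only [shiftedForm, Pi.smul_apply, smul_eq_mul, mul_add, Finset.mul_sum]
  congr 1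
  · exact Finset.sum_congr rfl fun v _ => by ring
  · refine Finset.sum_congr rfl fun u _ => Finset.sum_congr rfl fun v _ => ?_
    split_ifs <;> ring

theorem shiftedForm_comap {V W : Type*} [Fintype V] [Fintype W] (G : SimpleGraph V) (φ : W ≃ V)
    (t : ℝ) (x : V → ℝ) : shiftedForm (G.comap φ) t (x ∘ φ) = shiftedForm G t x := by
  classical
  simp only [shiftedForm, SimpleGraph.comap_adj, Function.comp_apply]
  congr 1
  · rw [Equiv.sum_comp φ fun v => x v ^ 2]
  · rw [← Equiv.sum_comp φ]
    refine Finset.sum_congr rfl fun u _ => ?_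
    convert Equiv.sum_comp φ fun v => if G.Adj (φ u) v then x (φ u) * x v else 0

theorem adjMat_isHermitian {n : ℕ} (G : SimpleGraph (Fin n)) : (adjMat G).IsHermitian := by
  classical
  ext i j
  simp only [Matrix.conjTranspose_apply, adjMat, Matrix.of_apply, star_trivial]
  exact if_congr (G.adj_comm j i) rfl rfl

theorem shiftedForm_eq_dotProduct {n : ℕ} (G : SimpleGraph (Fin n)) (t : ℝ) (x : Fin n → ℝ) :
    shiftedForm G t x = x ⬝ᵥ (adjMat G + t • 1).mulVec x := by
  rw [Matrix.add_mulVec, Matrix.smul_mulVec, Matrix.one_mulVec, dotProduct_add, dotProduct_smul,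
    shiftedForm, add_comm, smul_eq_mul]
  congr 1
  · simp only [dotProduct, Matrix.mulVec, adjMat, Matrix.of_apply, Finset.mul_sum]
    refine Finset.sum_congr rfl fun u _ => Finset.sum_congr rfl fun v _ => ?_
    split_ifs <;> ring
  · simp only [dotProduct, sq]

theorem neg_le_of_shiftedForm_nonneg {n : ℕ} {G : SimpleGraph (Fin n)} {t s : ℝ}
    (h : ∀ x, 0 ≤ shiftedForm G t x) {x : Fin n → ℝ} (hx : x ≠ 0)
    (hs : (adjMat G).mulVec x = s • x) : -t ≤ s := by
  have h1 := h x
  rw [shiftedForm_eq_dotProduct, Matrix.add_mulVec, hs, Matrix.smul_mulVec, Matrix.one_mulVec,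
    ← add_smul, dotProduct_smul, smul_eq_mul] at h1
  have h2 : 0 < x ⬝ᵥ x := by
    simpa using Matrix.dotProduct_star_self_pos_iff.2 hx
  have := nonneg_of_mul_nonneg_left h1 h2
  linarith

theorem neg_le_lam1 {n : ℕ} {G : SimpleGraph (Fin n)} {t : ℝ} (ht : 0 ≤ t)
    (h : ∀ x, 0 ≤ shiftedForm G t x) : -t ≤ lam1 G := by
  refine Real.le_sInf ?_ (by linarith)
  rintro s ⟨x, hx, hs⟩
  exact neg_le_of_shiftedForm_nonneg h hx hs

theorem bddBelow_eigenvalues {n : ℕ} (G : SimpleGraph (Fin n)) :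
    BddBelow {t : ℝ | ∃ x : Fin n → ℝ, x ≠ 0 ∧ (adjMat G).mulVec x = t • x} := by
  have hfin : {t : ℝ | ∃ x : Fin n → ℝ, x ≠ 0 ∧ (adjMat G).mulVec x = t • x} ⊆
      {t | Module.End.HasEigenvalue (Matrix.toLin' (adjMat G)) t} := by
    rintro t ⟨x, hx, h⟩
    refine Module.End.hasEigenvalue_of_hasEigenvector (x := x) ⟨?_, hx⟩
    rw [Module.End.mem_eigenspace_iff, Matrix.toLin'_apply, h]
  exact ((Module.End.finite_hasEigenvalue _).subset hfin).bddBelow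

theorem lam1_le_neg {n : ℕ} {G : SimpleGraph (Fin n)} {t : ℝ} {x : Fin n → ℝ} (hx : x ≠ 0)
    (h : shiftedForm G t x ≤ 0) : lam1 G ≤ -t := by
  have hB : (adjMat G + t • 1).IsHermitian :=
    (adjMat_isHermitian G).add (Matrix.isHermitian_one.smul (star_trivial t))
  have hex : ∃ i, hB.eigenvalues i ≤ 0 := by
    by_contra! hpos
    have hpd := hB.posDef_iff_eigenvalues_pos.2 hpos
    have := hpd.dotProduct_mulVec_pos hx
    rw [shiftedForm_eq_dotProduct] at h
    simp at this
    linarith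
  obtain ⟨i, hi⟩ := hex
  refine (csInf_le (bddBelow_eigenvalues G) (a := hB.eigenvalues i - t)
    ⟨hB.eigenvectorBasis i, ?_, ?_⟩).trans (by linarith)
  · intro h0
    apply hB.eigenvectorBasis.toBasis.ne_zero i
    ext j
    simpa using congrFun h0 j
  · have := hB.mulVec_eigenvectorBasis i
    rw [Matrix.add_mulVec, Matrix.smul_mulVec, Matrix.one_mulVec] at this
    rw [sub_smul, ← this, add_sub_cancel_right]

/-- The disjoint union of a family of rooted graphs, with all the roots joined to each other. -/
def rootClique {ι : Type*} {V : ι → Type*} (G : ∀ i, SimpleGraph (V i)) (r : ∀ i, V i) :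
    SimpleGraph (Σ i, V i) where
  Adj a b := (∃ i u v, (G i).Adj u v ∧ a = ⟨i, u⟩ ∧ b = ⟨i, v⟩) ∨
    (a.1 ≠ b.1 ∧ a.2 = r a.1 ∧ b.2 = r b.1)
  symm := ⟨by
    rintro a b (⟨i, u, v, h, ha, hb⟩ | ⟨h, ha, hb⟩)
    · exact Or.inl ⟨i, v, u, h.symm, hb, ha⟩
    · exact Or.inr ⟨h.symm, hb, ha⟩⟩
  loopless := ⟨by
    rintro a (⟨i, u, v, h, ha, hb⟩ | ⟨h, -⟩)
    · have := ha.symm.trans hb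
      simp only [Sigma.mk.injEq, heq_eq_eq, true_and] at this
      exact h.ne this
    · exact h rfl⟩

theorem rootClique_adj_same {ι : Type*} {V : ι → Type*} (G : ∀ i, SimpleGraph (V i))
    (r : ∀ i, V i) (i : ι) (u v : V i) :
    (rootClique G r).Adj ⟨i, u⟩ ⟨i, v⟩ ↔ (G i).Adj u v := by
  constructor
  · rintro (⟨j, u', v', h, ha, hb⟩ | ⟨h, -⟩)
    · cases ha
      cases hb
      exact h
    · exact absurd rfl h
  · exact fun h => Or.inl ⟨i, u, v, h, rfl, rfl⟩

theorem rootClique_adj_of_ne {ι : Type*} {V : ι → Type*} (G : ∀ i, SimpleGraph (V i))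
    (r : ∀ i, V i) {i j : ι} (hij : i ≠ j) (u : V i) (v : V j) :
    (rootClique G r).Adj ⟨i, u⟩ ⟨j, v⟩ ↔ u = r i ∧ v = r j := by
  constructor
  · rintro (⟨k, u', v', h, ha, hb⟩ | ⟨-, h⟩)
    · exact absurd ((congrArg Sigma.fst ha).trans (congrArg Sigma.fst hb).symm) hij
    · exact h
  · exact fun h => Or.inr ⟨hij, h⟩

theorem shiftedForm_rootClique {ι : Type*} [Fintype ι] [DecidableEq ι] {V : ι → Type*}
    [∀ i, Fintype (V i)] (G : ∀ i, SimpleGraph (V i)) (r : ∀ i, V i) (t : ℝ)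
    (x : (Σ i, V i) → ℝ) :
    shiftedForm (rootClique G r) t x = ∑ i, shiftedForm (G i) t (fun v => x ⟨i, v⟩) +
      ∑ i, ∑ j, if i = j then 0 else x ⟨i, r i⟩ * x ⟨j, r j⟩ := by
  classical
  simp only [shiftedForm, Fintype.sum_sigma, Finset.sum_add_distrib, ← Finset.mul_sum, add_assoc]
  congr 1
  rw [← Finset.sum_add_distrib]
  refine Finset.sum_congr rfl fun i _ => ?_
  rw [Finset.sum_comm, ← Finset.add_sum_erase _ _ (Finset.mem_univ i),
    ← Finset.add_sum_erase (Finset.univ) (fun j => if i = j then 0 else _) (Finset.mem_univ i)]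
  simp only [rootClique_adj_same, if_true, zero_add]
  congr 1
  refine Finset.sum_congr rfl fun j hj => ?_
  have hij : i ≠ j := (Finset.ne_of_mem_erase hj).symm
  simp only [rootClique_adj_of_ne G r hij, hij, if_false, ite_and]
  simp

/-- There is a `3`-colored rooted graph whose shifted form at `s` is bounded below by `d` times the
square of the value at the root, while its shifted form at `t` is at most `e` at some vector taking
the value `1` at the root. -/
def Realizable (s t d e : ℝ) : Prop :=
  ∃ (V : Type) (_ : Fintype V) (G : SimpleGraph V) (r : V) (c : V → Fin 3),
    (∀ u v, G.Adj u v → c u ≠ c v) ∧ c r = 0 ∧ (∀ x, d * x r ^ 2 ≤ shiftedForm G s x) ∧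
      ∃ x, x r = 1 ∧ shiftedForm G t x ≤ e

theorem realizable_vertex (s t : ℝ) : Realizable s t s t := by
  refine ⟨Unit, inferInstance, ⊥, (), 0, ?_, rfl, fun x => ?_, 1, rfl, ?_⟩ <;>
    simp [shiftedForm]

theorem Realizable.rootClique {s t : ℝ} {k : ℕ} (hk : k + 1 ≤ 3) {d e : Fin (k + 1) → ℝ}
    (h : ∀ i, Realizable s t (d i) (e i)) {D E : ℝ}
    (hD : ∀ y : Fin (k + 1) → ℝ, D * y 0 ^ 2 ≤ ∑ i, d i * y i ^ 2 +
      ∑ i, ∑ j, if i = j then 0 else y i * y j)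
    (hE : ∃ y : Fin (k + 1) → ℝ, y 0 = 1 ∧ ∑ i, e i * y i ^ 2 +
      (∑ i, ∑ j, if i = j then 0 else y i * y j) ≤ E) : Realizable s t D E := by
  choose V hV G r c hc hr hd x hx he using h
  obtain ⟨y, hy0, hy⟩ := hE
  refine ⟨Σ i, V i, inferInstance, _root_.rootClique G r, ⟨0, r 0⟩,
    fun a => c a.1 a.2 + Fin.castLE hk a.1, ?_, ?_, fun z => ?_, fun a => y a.1 * x a.1 a.2, ?_, ?_⟩
  · rintro ⟨i, u⟩ ⟨j, v⟩ hadj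
    by_cases hij : i = j
    · subst hij
      rw [rootClique_adj_same] at hadj
      simpa using hc i u v hadj
    · rw [rootClique_adj_of_ne G r hij] at hadj
      obtain ⟨rfl, rfl⟩ := hadj
      simpa [hr] using hij
  · simp [hr]
  · rw [shiftedForm_rootClique]
    refine (hD fun i => z ⟨i, r i⟩).trans ?_
    gcongr with i
    exact hd i fun v => z ⟨i, v⟩
  · simp [hy0, hx]
  · rw [shiftedForm_rootClique]
    refine le_trans ?_ hy
    simp only [hx, mul_one]
    gcongr with i
    have := shiftedForm_smul (G i) t (y i) (x i)
    simp only [Pi.smul_def, smul_eq_mul] at this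
    rw [this, mul_comm (e i)]
    exact mul_le_mul_of_nonneg_left (he i) (sq_nonneg _)

theorem Realizable.join {s t d e d' e' : ℝ} (h : Realizable s t d e) (h' : Realizable s t d' e')
    (hd : 0 < d') (he : 0 < e') : Realizable s t (d - 1 / d') (e - 1 / e') := by
  refine Realizable.rootClique (k := 1) (by norm_num) (d := ![d, d']) (e := ![e, e']) ?_ ?_ ?_
  · intro i
    fin_cases i
    exacts [h, h']
  · intro y
    simp [Fin.sum_univ_succ]
    have : d * y 0 ^ 2 + d' * y 1 ^ 2 + (y 0 * y 1 + y 1 * y 0) - (d - d'⁻¹) * y 0 ^ 2 =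
        d' * (y 1 + d'⁻¹ * y 0) ^ 2 := by
      field_simp
      ring
    nlinarith [mul_nonneg hd.le (sq_nonneg (y 1 + d'⁻¹ * y 0))]
  · refine ⟨![1, -1 / e'], rfl, le_of_eq ?_⟩
    simp [Fin.sum_univ_succ]
    field_simp
    ring

/-- The reduction of the value at a vertex joined to both ends of an edge whose ends have the
values `a` and `b`. -/
noncomputable def triangleLoss (a b : ℝ) : ℝ := (a + b - 2) / (a * b - 1)

theorem Realizable.triangle {s t d₀ e₀ d₁ e₁ d₂ e₂ : ℝ} (h₀ : Realizable s t d₀ e₀)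
    (h₁ : Realizable s t d₁ e₁) (h₂ : Realizable s t d₂ e₂) (hd₁ : 0 < d₁) (hd : 1 < d₁ * d₂)
    (he : 1 < e₁ * e₂) :
    Realizable s t (d₀ - triangleLoss d₁ d₂) (e₀ - triangleLoss e₁ e₂) := by
  refine Realizable.rootClique (k := 2) (by norm_num) (d := ![d₀, d₁, d₂]) (e := ![e₀, e₁, e₂])
    ?_ ?_ ?_
  · intro i
    fin_cases i
    exacts [h₀, h₁, h₂]
  · intro y
    simp [Fin.sum_univ_succ, triangleLoss]
    have hD : 0 < d₁ * d₂ - 1 := by linarith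
    have key : 0 ≤ ((d₁ * (y 1 + (d₂ - 1) / (d₁ * d₂ - 1) * y 0) +
        (y 2 + (d₁ - 1) / (d₁ * d₂ - 1) * y 0)) ^ 2 +
        (d₁ * d₂ - 1) * (y 2 + (d₁ - 1) / (d₁ * d₂ - 1) * y 0) ^ 2) / d₁ := by positivity
    refine sub_nonneg.1 (key.trans_eq ?_)
    field_simp
    ring
  · have hE : e₁ * e₂ - 1 ≠ 0 := by linarith
    refine ⟨![1, -(e₂ - 1) / (e₁ * e₂ - 1), -(e₁ - 1) / (e₁ * e₂ - 1)], rfl, le_of_eq ?_⟩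
    simp [Fin.sum_univ_succ, triangleLoss]
    field_simp
    ring

theorem Realizable.exists_lam1_mem_Icc {s t d e : ℝ} (h : Realizable s t d e) (hs : 0 ≤ s)
    (hd : 0 ≤ d) (he : e ≤ 0) :
    ∃ (n : ℕ) (G : SimpleGraph (Fin n)), G.chromaticNumber ≤ 3 ∧ lam1 G ∈ Set.Icc (-s) (-t) := by
  obtain ⟨V, _, G, r, c, hc, -, hG, x, hx, hxe⟩ := h
  let φ := (Fintype.equivFin V).symm
  refine ⟨Fintype.card V, G.comap φ, ?_, neg_le_lam1 hs fun y => ?_,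
    lam1_le_neg (x := x ∘ φ) (fun h0 => ?_) ?_⟩
  · have : (G.comap φ).Colorable 3 :=
      ⟨SimpleGraph.Coloring.mk (fun i => c (φ i)) fun {u v} huv => hc _ _ huv⟩
    exact_mod_cast this.chromaticNumber_le
  · have h1 := shiftedForm_comap G φ s (y ∘ φ.symm)
    rw [Function.comp_assoc, Equiv.symm_comp_self, Function.comp_id] at h1
    rw [h1]
    exact (mul_nonneg hd (sq_nonneg _)).trans (hG _)
  · have := congrFun h0 (φ.symm r)
    simp [hx] at this
  · rw [shiftedForm_comap]
    exact hxe.trans he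

theorem le_triangleLoss_sub {a b c d : ℝ} (hca : c ≤ a) (ha : a ≤ 1) (hdb : d ≤ b) (hc : 0 < c)
    (hcd : 1 < c * d) : a - c ≤ triangleLoss c d - triangleLoss a b := by
  have key : ∀ u v : ℝ, 0 < u → 1 < u * v →
      triangleLoss u v = 1 / u + (1 - u) ^ 2 / (u * (u * v - 1)) := by
    intro u v hu huv
    have : u * v - 1 ≠ 0 := by linarith
    rw [triangleLoss]
    field_simp
    ring
  have hd : 0 < d := pos_of_mul_pos_right (by linarith) hc.le
  have h1 : c * d ≤ a * b := mul_le_mul hca hdb hd.le (by linarith)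
  have h2 : 0 < c * d - 1 := by linarith
  rw [key c d hc hcd, key a b (by linarith) (by linarith)]
  have h3 : (1 - a) ^ 2 / (a * (a * b - 1)) ≤ (1 - c) ^ 2 / (c * (c * d - 1)) := by
    apply div_le_div₀ (sq_nonneg _)
    · exact pow_le_pow_left₀ (by linarith) (by linarith) 2
    · positivity
    · exact mul_le_mul hca (by linarith) h2.le (by linarith)
  have h4 : a - c ≤ 1 / c - 1 / a := by
    have : 0 < a := by linarith
    rw [div_sub_div _ _ hc.ne' this.ne', le_div_iff₀ (by positivity)]
    nlinarith [mul_nonneg (sub_nonneg.2 hca) (show 0 ≤ 1 - c * a by nlinarith)]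
  linarith

theorem sub_triangleLoss_le_iff {s d b : ℝ} (h : 1 < d * b) :
    s - triangleLoss d b ≤ d ↔ (s - d) * (d * b - 1) ≤ d + b - 2 := by
  rw [triangleLoss, sub_le_comm, le_div_iff₀ (by linarith)]

theorem Realizable.lt_snd {s t p x : ℝ} (hst : t < s) (hp : 0 < p) (hpx : p * x = 1)
    (hs : s = p + x) (hp1 : p < 1)
    (H : ∀ d e, Realizable s t d e → 0 < d → 0 < e) {d e : ℝ} (h : Realizable s t d e)
    (hd : p ≤ d) : p < e := by
  by_contra! he
  have hx : 1 < x := by nlinarith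
  have key : ∀ n : ℕ, ∃ d e, Realizable s t d e ∧ p ≤ d ∧ e ≤ p - n * (s - t) := by
    intro n
    induction n with
    | zero => exact ⟨d, e, h, hd, by simpa using he⟩
    | succ n ih =>
      obtain ⟨d, e, h, hd, he⟩ := ih
      have he0 := H d e h (by linarith)
      refine ⟨_, _, (realizable_vertex s t).join h (by linarith) he0, ?_, ?_⟩
      · have : 1 / d ≤ x := by rw [div_le_iff₀ (by linarith)]; nlinarith
        linarith
      · have hn : (0 : ℝ) ≤ n * (s - t) := by
          have := sub_pos.2 hst
          positivity
        have : s - e ≤ 1 / e := by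
          rw [le_div_iff₀ he0]
          nlinarith [mul_nonneg (show 0 ≤ p - e by linarith) (show 0 ≤ x - e by linarith)]
        push_cast
        linarith
  obtain ⟨n, hn⟩ := exists_nat_gt (p / (s - t))
  rw [div_lt_iff₀ (sub_pos.2 hst)] at hn
  obtain ⟨d, e, h, hd, he⟩ := key n
  have := H d e h (by linarith)
  linarith

theorem exists_realizable_nonpos_of_sq_add_lt {s t p x : ℝ} (ht : 0 < t) (hst : t < s) (hp : 0 < p)
    (hpx : p * x = 1) (hs : s = p + x) (hp1 : p < 1) (hgold : p ^ 4 + p ^ 2 < 1) :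
    ∃ d e, Realizable s t d e ∧ 0 < d ∧ e ≤ 0 := by
  by_contra! H
  have hlt : ∀ {d e}, Realizable s t d e → p ≤ d → p < e :=
    fun h => h.lt_snd hst hp hpx hs hp1 H
  have hx : 1 < x := by nlinarith
  have hs0 : 0 < s := by linarith
  obtain ⟨l, hl⟩ : ∃ l, l = 1 / s := ⟨_, rfl⟩
  have hls : l * s = 1 := by rw [hl]; field_simp
  have hl0 : 0 < l := by rw [hl]; positivity
  have hlt' : l ≤ 1 / t := by rw [hl]; exact one_div_le_one_div_of_le ht hst.le
  have hl' : l * (p ^ 2 + 1) = p := by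
    have : p * s = p ^ 2 + 1 := by rw [hs]; linear_combination hpx
    rw [← this]; linear_combination p * hls
  have hlx : p + l < x := by
    have : (p + l) * (p * (p ^ 2 + 1)) < x * (p * (p ^ 2 + 1)) := by
      have e1 : (p + l) * (p * (p ^ 2 + 1)) = p ^ 2 * (p ^ 2 + 1) + p ^ 2 := by
        linear_combination p * hl'
      have e2 : x * (p * (p ^ 2 + 1)) = p ^ 2 + 1 := by linear_combination (p ^ 2 + 1) * hpx
      rw [e1, e2]; linarith
    exact lt_of_mul_lt_mul_right this (by positivity)
  -- one step of the path extension, followed by the attachment of leaves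
  let C : ℝ → ℝ → ℝ := fun d e => (d - e) / ((d - p) * (x - e))
  obtain ⟨M, hM⟩ : ∃ M, M = s - 1 / (p + l) := ⟨_, rfl⟩
  have hMx : M < x := by
    have : p < 1 / (p + l) := by
      rw [lt_div_iff₀ (by positivity)]; nlinarith
    linarith
  have hM2 : 2 * (M - p) ≤ x - p + l := by
    have h2 : (x + p - l) * (p + l) ≤ 2 := by
      have e : ((x + p - l) * (p + l)) * (p * (p ^ 2 + 1) ^ 2) =
        (p ^ 4 + p ^ 2 + 1) * (p * (p ^ 2 + 2)) := by
        have a1 : (x + p - l) * (p * (p ^ 2 + 1)) = p ^ 4 + p ^ 2 + 1 := by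
          linear_combination (p ^ 2 + 1) * hpx - p * hl'
        have a2 : (p + l) * (p ^ 2 + 1) = p * (p ^ 2 + 2) := by linear_combination hl'
        rw [← a1, ← a2]; ring
      have : ((x + p - l) * (p + l)) * (p * (p ^ 2 + 1) ^ 2) ≤ 2 * (p * (p ^ 2 + 1) ^ 2) := by
        rw [e]
        have : 0 ≤ p * (p ^ 2 * (1 - p ^ 4 - p ^ 2)) :=
          mul_nonneg hp.le (mul_nonneg (sq_nonneg p) (by linarith))
        linarith
      exact le_of_mul_le_mul_right this (by positivity)
    have : (x + p - l) / 2 ≤ 1 / (p + l) := by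
      rw [div_le_div_iff₀ (by norm_num) (by positivity)]; linarith
    linarith
  have Cmono : ∀ {d e e'}, p < d → d < x → e' ≤ e → p ≤ e' → e ≤ d →
      C d e + (x - d) * (e - e') / (x - p) ^ 3 ≤ C d e' := by
    intro d e e' hpd hdx hee hpe hed
    have h1 : C d e' = C d e + (x - d) * (e - e') / ((d - p) * (x - e) * (x - e')) := by
      have n1 : d - p ≠ 0 := by linarith
      have n2 : x - e ≠ 0 := by linarith
      have n3 : x - e' ≠ 0 := by linarith
      simp only [C]
      field_simp
      ring
    rw [h1]
    gcongr
    · have : 0 < x - e := by linarith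
      have : 0 < x - e' := by linarith
      have : 0 < d - p := by linarith
      positivity
    · have : (x - p) ^ 3 = (x - p) * (x - p) * (x - p) := by ring
      have : 0 < x - p := by linarith
      rw [‹(x - p) ^ 3 = _›]
      gcongr <;> first | positivity | linarith
  have reduce : ∀ m : ℕ, ∀ d e, Realizable s t d e → p ≤ d → d < p + (m + 1) * l → e ≤ d →
      ∃ d' e', Realizable s t d' e' ∧ p ≤ d' ∧ d' < p + l ∧ e' ≤ d' ∧ (d ≤ M → C d e ≤ C d' e') := by
    intro m
    induction m with
    | zero =>
      intro d e h hd hd' he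
      exact ⟨d, e, h, hd, by simpa using hd', he, fun _ => le_rfl⟩
    | succ m ih =>
      intro d e h hd hd' he
      by_cases hdl : d < p + l
      · exact ⟨d, e, h, hd, hdl, he, fun _ => le_rfl⟩
      push Not at hdl
      have h' := h.join (realizable_vertex s t) hs0 ht
      rw [← hl] at h'
      have hpd : p ≤ d - l := by linarith
      have hpe := hlt h' hpd
      push_cast at hd'
      obtain ⟨d', e', hr, h1, h2, h3, h4⟩ := ih _ _ h' hpd (by linarith) (by linarith)
      refine ⟨d', e', hr, h1, h2, h3, fun hdM => le_trans ?_ (h4 (by linarith))⟩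
      have h5 := Cmono (d := d - l) (e := e - l) (e' := e - 1 / t) (by linarith) (by linarith)
        (by linarith) hpe.le (by linarith)
      have h6 : 0 ≤ (x - (d - l)) * (e - l - (e - 1 / t)) / (x - p) ^ 3 :=
        div_nonneg (mul_nonneg (by linarith) (by linarith)) (pow_nonneg (by linarith) 3)
      refine le_trans ?_ (by linarith : C (d - l) (e - l) ≤ _)
      simp only [C]
      rw [sub_sub_sub_cancel_right]
      apply div_le_div_of_nonneg_left (by linarith)
      · exact mul_pos (by linarith) (by linarith)
      · nlinarith [mul_nonneg hl0.le (show 0 ≤ (x - p + l) - (d - p) - (e - p) by linarith)]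
  have start : ∃ d e, Realizable s t d e ∧ p ≤ d ∧ d < p + l ∧ e ≤ d := by
    obtain ⟨m, hm⟩ := exists_nat_gt (s / l)
    rw [div_lt_iff₀ hl0] at hm
    obtain ⟨d, e, h, h1, h2, h3, -⟩ := reduce m s t (realizable_vertex s t) (by linarith)
      (by linarith) hst.le
    exact ⟨d, e, h, h1, h2, h3⟩
  obtain ⟨κ, hκ⟩ : ∃ κ, κ = (x - M) * (s - t) / (x - p) ^ 3 := ⟨_, rfl⟩
  have hκ0 : 0 < κ := by
    have : 0 < x - M := by linarith
    have : 0 < s - t := by linarith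
    have : 0 < x - p := by linarith
    rw [hκ]; positivity
  have iter : ∀ n : ℕ, ∃ d e, Realizable s t d e ∧ p ≤ d ∧ d < p + l ∧ e ≤ d ∧ n * κ ≤ C d e := by
    intro n
    induction n with
    | zero =>
      obtain ⟨d, e, h, h1, h2, h3⟩ := start
      refine ⟨d, e, h, h1, h2, h3, ?_⟩
      rw [Nat.cast_zero, zero_mul]
      exact div_nonneg (by linarith) (mul_nonneg (by linarith) (by linarith))
    | succ n ih =>
      obtain ⟨d, e, h, h1, h2, h3, h4⟩ := ih
      have hpe := hlt h h1
      have hd0 : 0 < d := by linarith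
      have he0 : 0 < e := by linarith
      have h' := (realizable_vertex s t).join h hd0 he0
      have hdp : p < s - 1 / d := by
        have : 1 / d < x := by rw [div_lt_iff₀ hd0]; nlinarith
        linarith
      have hdM : s - 1 / d ≤ M := by
        have : 1 / (p + l) ≤ 1 / d := one_div_le_one_div_of_le hd0 h2.le
        linarith
      have hed : 1 / d ≤ 1 / e := one_div_le_one_div_of_le he0 h3
      obtain ⟨m, hm⟩ := exists_nat_gt (s / l)
      rw [div_lt_iff₀ hl0] at hm
      have hd1 : 0 < 1 / d := by positivity
      obtain ⟨d', e', hr, g1, g2, g3, g4⟩ := reduce m _ _ h' hdp.le (by linarith) (by linarith)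
      refine ⟨d', e', hr, g1, g2, g3, le_trans ?_ (g4 hdM)⟩
      have hpe' := hlt h' hdp.le
      have g5 := Cmono (d := s - 1 / d) (e := s - 1 / e) (e' := t - 1 / e) hdp (by linarith)
        (by linarith) hpe'.le (by linarith)
      have g6 : C (s - 1 / d) (s - 1 / e) = C d e := by
        have e1 : s - 1 / d - (s - 1 / e) = (d - e) / (d * e) := by field_simp; ring
        have e2 : s - 1 / d - p = x * (d - p) / d := by
          rw [hs]; field_simp; linear_combination hpx
        have e3 : x - (s - 1 / e) = p * (x - e) / e := by
          rw [hs]; field_simp; linear_combination -hpx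
        have e4 : x * (d - p) / d * (p * (x - e) / e) = (d - p) * (x - e) / (d * e) := by
          field_simp; linear_combination (d - p) * (x - e) * hpx
        simp only [C]
        rw [e1, e2, e3, e4, div_div_div_cancel_right₀ (by positivity)]
      have g7 : κ ≤ (x - (s - 1 / d)) * (s - 1 / e - (t - 1 / e)) / (x - p) ^ 3 := by
        rw [hκ, sub_sub_sub_cancel_right]
        have : 0 < s - t := by linarith
        have : 0 < x - p := by linarith
        gcongr
      push_cast
      linarith
  obtain ⟨n, hn⟩ := exists_nat_gt (1 / ((x - p) * κ))
  rw [div_lt_iff₀ (mul_pos (by linarith) hκ0)] at hn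
  obtain ⟨d, e, h, h1, h2, h3, h4⟩ := iter n
  have hpe := hlt h h1
  have h5 : (x - p) * C d e < 1 := by
    simp only [C]
    rw [← mul_div_assoc, div_lt_one (mul_pos (by linarith) (by linarith))]
    nlinarith [mul_pos (show 0 < x - d by linarith) (show 0 < e - p by linarith)]
  have h6 := mul_le_mul_of_nonneg_left h4 (show 0 ≤ x - p by linarith)
  nlinarith
theorem lt_of_one_le_pow_four_add_sq {p : ℝ} (hp : 0 < p) (hgold : 1 ≤ p ^ 4 + p ^ 2) :
    0.785 < p := by
  by_contra! h
  have h2 : p ^ 2 ≤ 0.785 ^ 2 := pow_le_pow_left₀ hp.le h 2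
  have h4 : p ^ 4 ≤ 0.785 ^ 4 := pow_le_pow_left₀ hp.le h 4
  norm_num at h2 h4
  linarith

theorem sub_one_div_le_of_triangle_lt {s p x d : ℝ} (hp : 0 < p) (hpx : p * x = 1)
    (hs : s = p + x) (hp1 : p < 1) (hgold : 1 ≤ p ^ 4 + p ^ 2) (hd : p ≤ d)
    (hlt : s - triangleLoss d s < p) :
    s - 1 / d ≤ 1 ∧ s - triangleLoss (s - 1 / d) s ≤ s - 1 / d := by
  have hp785 := lt_of_one_le_pow_four_add_sq hp hgold
  have hx : 1 < x := by nlinarith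
  have hs2 : 2 < s := by nlinarith [sq_nonneg (x - p)]
  have hd0 : 0 < d := by linarith
  have hps : p * s = p ^ 2 + 1 := by rw [hs]; linear_combination hpx
  have hds : 1 < d * s := by nlinarith
  -- the bound on `d` beyond which a triangle can be attached
  obtain ⟨c, hc⟩ : ∃ c, c = p * (1 + (1 - p) ^ 2) := ⟨_, rfl⟩
  have hdc : d < c := by
    have h1 : x < triangleLoss d s := by linarith
    rw [triangleLoss, lt_div_iff₀ (by linarith)] at h1
    have h2 : p ^ 2 * (x * (d * s - 1)) < p ^ 2 * (d + s - 2) :=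
      mul_lt_mul_of_pos_left h1 (by positivity)
    have e1 : p ^ 2 * (x * (d * s - 1)) - p ^ 2 * (d + s - 2) = d - c := by
      rw [hc, hs]
      linear_combination (d * p * x + p ^ 2 * d + d - 2 * p) * hpx
    linarith
  have hc1 : c ≤ 1 := by rw [hc]; nlinarith [sq_nonneg (1 - p)]
  have hfs : p ≤ s - 1 / d := by
    have : 1 / d ≤ x := by rw [div_le_iff₀ hd0]; nlinarith
    linarith
  constructor
  · rw [sub_le_comm, le_div_iff₀ hd0]
    have h1 : c * (s - 1) ≤ 1 := by
      have e : c * (s - 1) = 1 - (1 - p) * (1 - 2 * (1 - p) + (1 - p) ^ 2 - (1 - p) ^ 3) := by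
        rw [hc]; linear_combination (1 + (1 - p) ^ 2) * hps
      have : 0 ≤ (1 - p) * (1 - 2 * (1 - p) + (1 - p) ^ 2 - (1 - p) ^ 3) := by
        apply mul_nonneg (by linarith)
        nlinarith [mul_nonneg (sq_nonneg (1 - p)) hp.le]
      linarith
    nlinarith
  · rw [sub_triangleLoss_le_iff (by nlinarith)]
    have hg : 0 ≤ (2 * s - 2) * d ^ 2 - s ^ 2 * d + s := by
      have h1 : 0 ≤ (2 * s - 2) * c ^ 2 - s ^ 2 * c + s := by
        obtain ⟨w, hw⟩ : ∃ w, w = 1 - p := ⟨_, rfl⟩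
        have e : ((2 * s - 2) * c ^ 2 - s ^ 2 * c + s) * p = w ^ 2 *
            (1 - 6 * w + 11 * w ^ 2 - 14 * w ^ 3 + 11 * w ^ 4 - 6 * w ^ 5 + 2 * w ^ 6) := by
          have hpw : p = 1 - w := by linarith
          rw [show ((2 * s - 2) * c ^ 2 - s ^ 2 * c + s) * p =
            2 * (p * s - p) * p ^ 2 * (1 + (1 - p) ^ 2) ^ 2 - (p * s) ^ 2 * (1 + (1 - p) ^ 2) +
            p * s by rw [hc]; ring, hps, hpw]
          ring
        have hw0 : 0 < w := by linarith
        have hw1 : w < 0.215 := by linarith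
        have h2 : 0 ≤ 1 - 6 * w + 11 * w ^ 2 - 14 * w ^ 3 := by
          nlinarith [mul_nonneg hw0.le (sq_nonneg (w - 0.215)), sq_nonneg (w - 0.215),
            mul_pos hw0 (sub_pos.2 hw1)]
        have h3 : 0 ≤ w ^ 4 * (11 - 6 * w) := mul_nonneg (by positivity) (by linarith)
        have h4 : 0 ≤ w ^ 6 := by positivity
        have h5 : 0 ≤ w ^ 2 *
            (1 - 6 * w + 11 * w ^ 2 - 14 * w ^ 3 + 11 * w ^ 4 - 6 * w ^ 5 + 2 * w ^ 6) :=
          mul_nonneg (sq_nonneg w) (by linarith)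
        rw [← e] at h5
        exact nonneg_of_mul_nonneg_left h5 hp
      have h2 : (2 * s - 2) * (d + c) ≤ s ^ 2 := by
        nlinarith [sq_nonneg (s - 2), mul_nonneg (show 0 ≤ 2 * s - 2 by linarith)
          (show 0 ≤ 2 - (d + c) by linarith)]
      nlinarith [mul_nonneg (sub_nonneg.2 hdc.le) (sub_nonneg.2 h2)]
    have e : s - 1 / d + s - 2 - (s - (s - 1 / d)) * ((s - 1 / d) * s - 1) =
        ((2 * s - 2) * d ^ 2 - s ^ 2 * d + s) / d ^ 2 := by
      field_simp
      ring
    have := div_nonneg hg (sq_nonneg d)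
    linarith

theorem one_lt_mul_sub_one_div {s p x d : ℝ} (hp : 0 < p) (hpx : p * x = 1)
    (hs : s = p + x) (hd : p ≤ d) : 1 < d * (s - 1 / s) := by
  have hx : 0 < x := pos_of_mul_pos_right (by linarith) hp.le
  have hs0 : 0 < s := by linarith
  have h1 : 1 / s < p := by
    rw [div_lt_iff₀ hs0]; nlinarith
  nlinarith

theorem le_sub_triangleLoss_of_lt {s p x d : ℝ} (hp : 0 < p) (hpx : p * x = 1)
    (hs : s = p + x) (hp1 : p < 1) (hgold : 1 ≤ p ^ 4 + p ^ 2) (hd : p ≤ d) (hd1 : d ≤ 1)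
    (hlt : d < s - triangleLoss d s) : p ≤ s - triangleLoss d (s - 1 / s) := by
  have hx : 1 < x := by nlinarith
  have hs2 : 2 < s := by nlinarith [sq_nonneg (x - p)]
  have hd0 : 0 < d := by linarith
  have hps : p * s = p ^ 2 + 1 := by rw [hs]; linear_combination hpx
  have hds : 1 < d * s := by nlinarith
  have hdτ := one_lt_mul_sub_one_div hp hpx hs hd
  have hlt' := mt (sub_triangleLoss_le_iff hds).2 (not_le.2 hlt)
  push Not at hlt'
  -- the bound on `d` beyond which a triangle with a pendant edge can be attached
  obtain ⟨c, hc⟩ : ∃ c, c = p * (1 + (1 - p) ^ 2 * (1 + p ^ 2)) := ⟨_, rfl⟩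
  have hc1 : c ≤ 1 := by
    have e : 1 - c = (1 - p) * (1 - p * (1 - p) * (1 + p ^ 2)) := by rw [hc]; ring
    have h1 : p * (1 - p) * (1 + p ^ 2) ≤ (1 / 4) * 2 := by
      apply mul_le_mul _ _ (by positivity) (by norm_num) <;> nlinarith [sq_nonneg (p - 1 / 2)]
    have := mul_nonneg (sub_nonneg.2 hp1.le)
      (show 0 ≤ 1 - p * (1 - p) * (1 + p ^ 2) by linarith)
    linarith
  have hcQ : 0 ≤ s * c ^ 2 - s ^ 2 * c + 2 * s - 2 := by
    have e : (s * c ^ 2 - s ^ 2 * c + 2 * s - 2) * p = (1 - p) ^ 2 *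
        (p ^ 2 * (p ^ 4 + p ^ 2 - 1) + (1 - p) ^ 2 * (1 + p ^ 2) ^ 3 * p ^ 2) := by
      rw [show (s * c ^ 2 - s ^ 2 * c + 2 * s - 2) * p =
        (p * s) * p ^ 2 * (1 + (1 - p) ^ 2 * (1 + p ^ 2)) ^ 2 -
        (p * s) ^ 2 * (1 + (1 - p) ^ 2 * (1 + p ^ 2)) + 2 * (p * s) - 2 * p by rw [hc]; ring, hps]
      ring
    have h1 : 0 ≤ p ^ 2 * (p ^ 4 + p ^ 2 - 1) := mul_nonneg (sq_nonneg p) (by linarith)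
    have h2 : 0 ≤ (1 - p) ^ 2 *
        (p ^ 2 * (p ^ 4 + p ^ 2 - 1) + (1 - p) ^ 2 * (1 + p ^ 2) ^ 3 * p ^ 2) := by positivity
    rw [← e] at h2
    exact nonneg_of_mul_nonneg_left h2 hp
  have hcd : c ≤ d := by
    by_contra! h
    nlinarith [mul_nonneg (sub_nonneg.2 h.le)
      (mul_nonneg (show 0 ≤ s by linarith) (show 0 ≤ s - (d + c) by linarith))]
  suffices triangleLoss d (s - 1 / s) ≤ x by linarith
  rw [triangleLoss, div_le_iff₀ (by linarith)]
  have hx' : x = 1 / p := by field_simp; linarith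
  have e : x * (d * (s - 1 / s) - 1) - (d + (s - 1 / s) - 2) = (d - c) / (p ^ 2 * (1 + p ^ 2)) := by
    rw [show s = (1 + p ^ 2) / p by field_simp; linarith, hx', hc]
    field_simp
    ring
  have := div_nonneg (sub_nonneg.2 hcd) (show 0 ≤ p ^ 2 * (1 + p ^ 2) by positivity)
  linarith

theorem sq_mul_sq_sub_four_le {s p x : ℝ} (hp : 0 < p) (hpx : p * x = 1)
    (hs : s = p + x) (hp1 : p < 1) (hgold : 1 ≤ p ^ 4 + p ^ 2) : s ^ 2 * (s ^ 2 - 4) ≤ 1 := by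
  have hx : 1 < x := by nlinarith
  have h0 : 0 ≤ x ^ 2 - p ^ 2 := by nlinarith
  have h1 : x ^ 2 - p ^ 2 ≤ 1 := by
    have : x ^ 2 * 1 ≤ x ^ 2 * (p ^ 4 + p ^ 2) := mul_le_mul_of_nonneg_left hgold (by positivity)
    have e : x ^ 2 * (p ^ 4 + p ^ 2) = p ^ 2 + 1 := by
      linear_combination (p ^ 2 + 1) * (p * x + 1) * hpx
    linarith
  have e : s ^ 2 * (s ^ 2 - 4) = (x ^ 2 - p ^ 2) ^ 2 := by
    rw [hs]
    linear_combination 4 * (x + p) ^ 2 * hpx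
  rw [e]
  nlinarith

theorem tripod_one_two_bounds {s p x : ℝ} (hp : 0 < p) (hpx : p * x = 1) (hs : s = p + x)
    (hp1 : p < 1) (hx : x ^ 2 + 1 ≤ x ^ 6) (hs' : s ≤ 2.0375) :
    p ≤ s - 1 / s - 1 / (s - 1 / s) ∧ s - 1 / s - 1 / (s - 1 / s) ≤ 1 ∧
      s - triangleLoss (s - 1 / s - 1 / (s - 1 / s)) (s - 1 / s) ≤
        s - 1 / s - 1 / (s - 1 / s) := by
  have hx1 : 1 < x := by nlinarith
  have hs2 : 2 < s := by nlinarith [sq_nonneg (x - p)]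
  have hs0 : 0 < s := by linarith
  have hτ : s - 1 / s = (s ^ 2 - 1) / s := by field_simp
  have hm : 3 < s ^ 2 - 1 := by nlinarith
  have hA : p ≤ s - 1 / s - 1 / (s - 1 / s) := by
    have hp' : p = 1 / x := by field_simp; linarith
    have hs'' : s = (1 + x ^ 2) / x := by rw [hs, hp']; field_simp
    have e : s - 1 / s - 1 / (s - 1 / s) - p =
        (x ^ 6 - x ^ 2 - 1) / ((1 + x ^ 2) * (x * (x ^ 4 + x ^ 2 + 1))) * x ^ 2 := by
      have h1 : x ^ 4 + x ^ 2 + 1 ≠ 0 := by positivity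
      have h2 : (1 + x ^ 2) ^ 2 - x ^ 2 = x ^ 4 + x ^ 2 + 1 := by ring
      have h3 : s - 1 / s = (x ^ 4 + x ^ 2 + 1) / (x * (1 + x ^ 2)) := by
        rw [hs'']
        field_simp
        ring
      rw [h3, hp']
      field_simp
      ring
    have : 0 ≤ (x ^ 6 - x ^ 2 - 1) / ((1 + x ^ 2) * (x * (x ^ 4 + x ^ 2 + 1))) * x ^ 2 :=
      mul_nonneg (div_nonneg (by linarith) (by positivity)) (by positivity)
    linarith
  refine ⟨hA, ?_, ?_⟩
  · have h1 : s - 1 / s ≤ 1.6 := by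
      have : 0.45 ≤ 1 / s := by rw [le_div_iff₀ hs0]; linarith
      linarith
    have h2 : 0.625 ≤ 1 / (s - 1 / s) := by
      rw [le_div_iff₀ (by rw [hτ]; positivity)]
      linarith
    linarith
  · rw [sub_triangleLoss_le_iff (one_lt_mul_sub_one_div hp hpx hs hA)]
    have hm' : s ^ 2 - 1 ≠ 0 := by linarith
    have e : s - 1 / s - 1 / (s - 1 / s) + (s - 1 / s) - 2 - (s - (s - 1 / s - 1 / (s - 1 / s))) *
        ((s - 1 / s - 1 / (s - 1 / s)) * (s - 1 / s) - 1) =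
        (1 - 2 * (s ^ 2 * (s ^ 2 - 1) * (s - 2))) / (s ^ 3 * (s ^ 2 - 1)) := by
      rw [hτ]
      field_simp
      ring
    have h1 : s ^ 2 * (s ^ 2 - 1) * (s - 2) ≤ 2.0375 ^ 2 * (2.0375 ^ 2 - 1) * (2.0375 - 2) := by
      gcongr
    have : 0 ≤ (1 - 2 * (s ^ 2 * (s ^ 2 - 1) * (s - 2))) / (s ^ 3 * (s ^ 2 - 1)) := by
      apply div_nonneg
      · norm_num at h1
        linarith
      · positivity
    linarith

theorem two_mul_quartic_le_cubic {m : ℝ} (hm : 4.151 < m) (hm' : m < 4.2361) :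
    0 ≤ 4 * m ^ 3 - 17 * m ^ 2 + 23 * m - 9 -
      2 * ((m + 4.2025) / 4.1 * (m * (m - 2) ^ 2)) := by
  obtain ⟨v, rfl⟩ : ∃ v, m = 4.151 + v := ⟨m - 4.151, by ring⟩
  have hv : 0 < v := by linarith
  have hv' : 0 < 0.0851 - v := by linarith
  have h1 : 0 < v * (0.0851 - v) := mul_pos hv hv'
  have h2 : 0 < v * (v * (0.0851 - v)) := mul_pos hv h1
  have h3 : 0 < v * (v * (v * (0.0851 - v))) := mul_pos hv h2
  ring_nf at h1 h2 h3 hv' ⊢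
  linarith

theorem tripod_one_three_bounds {s p x : ℝ} (hp : 0 < p) (hpx : p * x = 1) (hs : s = p + x)
    (hp1 : p < 1) (hgold : 1 ≤ p ^ 4 + p ^ 2) (hs' : 2.0375 < s) :
    p ≤ s - 1 / s - 1 / (s - 1 / (s - 1 / s)) ∧ s - 1 / s - 1 / (s - 1 / (s - 1 / s)) ≤ 1 ∧
      s - triangleLoss (s - 1 / s - 1 / (s - 1 / (s - 1 / s))) (s - 1 / s) ≤
        s - 1 / s - 1 / (s - 1 / (s - 1 / s)) := by
  have hx1 : 1 < x := by nlinarith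
  have hs0 : 0 < s := by linarith
  have hτ : s - 1 / s = (s ^ 2 - 1) / s := by field_simp
  have hup := sq_mul_sq_sub_four_le hp hpx hs hp1 hgold
  obtain ⟨m, hm⟩ : ∃ m, m = s ^ 2 := ⟨_, rfl⟩
  have hm1 : 4.151 < m := by nlinarith
  have hm2 : m < 4.2361 := by rw [← hm] at hup; nlinarith
  have hm0 : 0 < m - 1 := by linarith
  have hm0' : 0 < m - 2 := by linarith
  have hB : s - 1 / s - 1 / (s - 1 / (s - 1 / s)) = (m - 1) * (m - 3) / (s * (m - 2)) := by
    rw [hτ, ← hm]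
    have h1 : s - 1 / ((m - 1) / s) = s * (m - 2) / (m - 1) := by
      field_simp
      ring
    rw [h1, one_div_div]
    field_simp
    ring
  rw [hB]
  obtain ⟨B, hB'⟩ : ∃ B, B = (m - 1) * (m - 3) / (s * (m - 2)) := ⟨_, rfl⟩
  rw [← hB']
  have hB1 : B ≤ 1 := by
    rw [hB', div_le_one (by positivity)]
    nlinarith
  have hpB : p ≤ B := by
    by_contra! h
    have h1 : 0 < (p - B) * (x - B) := mul_pos (by linarith) (by linarith)
    have h2 : (p - B) * (x - B) = B ^ 2 - s * B + 1 := by rw [hs]; linear_combination hpx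
    have h3 : B ^ 2 - s * B + 1 = (-m ^ 3 + 7 * m ^ 2 - 14 * m + 9) / (m * (m - 2) ^ 2) := by
      rw [hB', hm]
      rw [hm] at hm0'
      field_simp
      ring
    have h4 : (-m ^ 3 + 7 * m ^ 2 - 14 * m + 9) / (m * (m - 2) ^ 2) ≤ 0 := by
      apply div_nonpos_of_nonpos_of_nonneg _ (by positivity)
      nlinarith [mul_pos (sub_pos.2 hm1) (sub_pos.2 hm2)]
    linarith
  refine ⟨hpB, hB1, ?_⟩
  rw [sub_triangleLoss_le_iff (one_lt_mul_sub_one_div hp hpx hs hpB)]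
  have e : B + (s - 1 / s) - 2 - (s - B) * (B * (s - 1 / s) - 1) =
      (4 * m ^ 3 - 17 * m ^ 2 + 23 * m - 9 - 2 * s * (m * (m - 2) ^ 2)) /
        (s * (m * (m - 2) ^ 2)) := by
    rw [hB', hτ, hm]
    rw [hm] at hm0'
    field_simp
    ring
  have h1 : s ≤ (m + 4.2025) / 4.1 := by
    rw [le_div_iff₀ (by norm_num)]
    nlinarith [sq_nonneg (s - 2.05)]
  have h2 : s * (m * (m - 2) ^ 2) ≤ (m + 4.2025) / 4.1 * (m * (m - 2) ^ 2) :=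
    mul_le_mul_of_nonneg_right h1 (by positivity)
  have h3 := two_mul_quartic_le_cubic hm1 hm2
  have h4 : 0 ≤ (4 * m ^ 3 - 17 * m ^ 2 + 23 * m - 9 - 2 * s * (m * (m - 2) ^ 2)) /
        (s * (m * (m - 2) ^ 2)) := div_nonneg (by linarith) (by positivity)
  linarith


theorem exists_realizable_nonpos_of_le_sq_add {s t p x : ℝ} (ht : 0 < t) (hst : t < s) (hp : 0 < p)
    (hpx : p * x = 1) (hs : s = p + x) (hp1 : p < 1) (hgold : 1 ≤ p ^ 4 + p ^ 2)
    (hx : x ^ 2 + 1 ≤ x ^ 6) : ∃ d e, Realizable s t d e ∧ 0 < d ∧ e ≤ 0 := by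
  by_contra! H
  have hx1 : 1 < x := by nlinarith
  have hs2 : 2 < s := by nlinarith [sq_nonneg (x - p)]
  have hvertex := realizable_vertex s t
  have join : ∀ {d e d' e'}, Realizable s t d e → Realizable s t d' e' → 0 < d' →
      Realizable s t (d - 1 / d') (e - 1 / e') := fun h h' hd' => h.join h' hd' (H _ _ h' hd')
  have hinv : 1 / s < 1 / 2 := one_div_lt_one_div_of_lt (by norm_num) hs2
  have hedge : Realizable s t (s - 1 / s) (t - 1 / t) := join hvertex hvertex (by linarith)
  have hedge0 : t - 1 / t ≤ s - 1 / s := by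
    have := one_div_le_one_div_of_le ht hst.le
    linarith
  have htri : ∀ {d e b c}, Realizable s t d e → Realizable s t b c → p ≤ d → d ≤ 1 → e ≤ d →
      c ≤ b → 1 < d * b → Realizable s t (s - triangleLoss d b) (t - triangleLoss e c) ∧
        d - e + (s - t) ≤ s - triangleLoss d b - (t - triangleLoss e c) := by
    intro d e b c h h' hd hd1 hed hcb hdb
    have hd0 : 0 < d := by linarith
    have he0 := H d e h hd0
    have hc := H _ _ (join h' h hd0) (by rw [sub_pos, div_lt_iff₀ hd0]; linarith)
    rw [sub_pos, div_lt_iff₀ he0, mul_comm] at hc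
    have := le_triangleLoss_sub hed hd1 hcb he0 hc
    exact ⟨hvertex.triangle h h' hd0 hdb hc, by linarith⟩
  have step : ∀ d e, Realizable s t d e → p ≤ d → d ≤ 1 → e ≤ d →
      s - triangleLoss d (s - 1 / s) ≤ d → ∃ d' e', Realizable s t d' e' ∧ p ≤ d' ∧ d' ≤ 1 ∧
        d - e + (s - t) ≤ d' - e' ∧ s - triangleLoss d' (s - 1 / s) ≤ d' := by
    intro d e h hd hd1 hed hinv'
    have hd0 : 0 < d := by linarith
    have he0 := H d e h hd0
    have hds : 1 < d * (s - 1 / s) := one_lt_mul_sub_one_div hp hpx hs hd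
    have hds' : 1 < d * s := by
      have : 0 < d * (1 / s) := by positivity
      linarith
    have hmono : ∀ {d'}, p ≤ d' → d' ≤ 1 →
        s - triangleLoss d' (s - 1 / s) ≤ s - triangleLoss d' s := by
      intro d' h1 h2
      have := le_triangleLoss_sub le_rfl h2 (show s - 1 / s ≤ s by linarith [one_div_pos.2 (ht.trans hst)])
        (by linarith) (one_lt_mul_sub_one_div hp hpx hs h1)
      linarith
    by_cases h1 : s - triangleLoss d s ≤ d
    · by_cases h2 : s - triangleLoss d s < p
      · obtain ⟨h3, h4⟩ := sub_one_div_le_of_triangle_lt hp hpx hs hp1 hgold hd h2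
        have h5 : p ≤ s - 1 / d := by
          have : 1 / d ≤ x := by rw [div_le_iff₀ hd0]; nlinarith
          linarith
        refine ⟨_, _, join hvertex h hd0, h5, h3, ?_, (hmono h5 h3).trans h4⟩
        have : d - e ≤ 1 / e - 1 / d := by
          rw [div_sub_div _ _ he0.ne' hd0.ne', le_div_iff₀ (by positivity)]
          nlinarith [mul_nonneg (sub_nonneg.2 hed) (show 0 ≤ 1 - e * d by nlinarith)]
        linarith
      · push Not at h2
        obtain ⟨h3, h4⟩ := htri h hvertex hd hd1 hed hst.le hds'
        refine ⟨_, _, h3, h2, h1.trans hd1, h4, (hmono h2 (h1.trans hd1)).trans ?_⟩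
        have := le_triangleLoss_sub h1 hd1 (le_refl s) (by linarith)
          (show 1 < (s - triangleLoss d s) * s by nlinarith)
        linarith
    · push Not at h1
      have h2 := le_sub_triangleLoss_of_lt hp hpx hs hp1 hgold hd hd1 h1
      obtain ⟨h3, h4⟩ := htri h hedge hd hd1 hed hedge0 hds
      refine ⟨_, _, h3, h2, hinv'.trans hd1, h4, ?_⟩
      have := le_triangleLoss_sub hinv' hd1 (le_refl (s - 1 / s)) (by linarith)
        (one_lt_mul_sub_one_div hp hpx hs h2)
      linarith
  have start : ∃ d e, Realizable s t d e ∧ p ≤ d ∧ d ≤ 1 ∧ e ≤ d ∧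
      s - triangleLoss d (s - 1 / s) ≤ d := by
    have he0 := H _ _ hedge (by linarith)
    have h1 := one_div_le_one_div_of_le he0 hedge0
    have hinv2 : 1 / (s - 1 / s) < 1 := by rw [div_lt_one] <;> linarith
    rcases le_or_gt s 2.0375 with h | h
    · obtain ⟨h2, h3, h4⟩ := tripod_one_two_bounds hp hpx hs hp1 hx h
      exact ⟨_, _, join hedge hedge (by linarith), h2, h3, by linarith, h4⟩
    · obtain ⟨h2, h3, h4⟩ := tripod_one_three_bounds hp hpx hs hp1 hgold h
      have hpath := join hvertex hedge (by linarith)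
      have h5 := one_div_le_one_div_of_le (H _ _ hpath (by linarith))
        (show t - 1 / (t - 1 / t) ≤ s - 1 / (s - 1 / s) by linarith)
      exact ⟨_, _, join hedge hpath (by linarith), h2, h3, by linarith, h4⟩
  have iter : ∀ n : ℕ, ∃ d e, Realizable s t d e ∧ p ≤ d ∧ d ≤ 1 ∧ n * (s - t) ≤ d - e ∧
      s - triangleLoss d (s - 1 / s) ≤ d := by
    intro n
    induction n with
    | zero =>
      obtain ⟨d, e, h, h1, h2, h3, h4⟩ := start
      exact ⟨d, e, h, h1, h2, by simpa using h3, h4⟩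
    | succ n ih =>
      obtain ⟨d, e, h, h1, h2, h3, h4⟩ := ih
      have : 0 ≤ n * (s - t) := mul_nonneg n.cast_nonneg (by linarith)
      obtain ⟨d', e', h', g1, g2, g3, g4⟩ := step d e h h1 h2 (by linarith) h4
      exact ⟨d', e', h', g1, g2, by push_cast; linarith, g4⟩
  obtain ⟨n, hn⟩ := exists_nat_gt (1 / (s - t))
  rw [div_lt_iff₀ (sub_pos.2 hst)] at hn
  obtain ⟨d, e, h, h1, h2, h3, -⟩ := iter n
  have := H d e h (by linarith)
  linarith

/-- For every `λ > λ*` and every `ε > 0`, there exists a finite simple graph `G` with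
chromatic number at most `3` such that `λ₁(G) ∈ (-λ - ε, -λ)`, where `λ* = √ρ + 1/√ρ`
and `ρ` is the unique real root of `x³ = x + 1`. -/
theorem exists_three_colorable_lam1_mem_Ioo (ρ : ℝ) (hρ : ρ ^ 3 = ρ + 1)
    (lamStar : ℝ) (hlamStar : lamStar = Real.sqrt ρ + (Real.sqrt ρ)⁻¹)
    (lam : ℝ) (hlam : lamStar < lam) (ε : ℝ) (hε : 0 < ε) :
    ∃ (n : ℕ) (G : SimpleGraph (Fin n)),
      G.chromaticNumber ≤ 3 ∧ lam1 G ∈ Set.Ioo (-lam - ε) (-lam) := by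
  have hρ1 : 1 < ρ := by nlinarith [sq_nonneg (ρ + 1), sq_nonneg (ρ - 1), sq_nonneg ρ]
  have hr2 : Real.sqrt ρ ^ 2 = ρ := Real.sq_sqrt (by linarith)
  have hr1 : 1 < Real.sqrt ρ := by rw [Real.lt_sqrt] <;> linarith
  obtain ⟨r, hr⟩ : ∃ r, r = Real.sqrt ρ := ⟨_, rfl⟩
  rw [← hr] at hlamStar hr2 hr1
  have hrr : r * r⁻¹ = 1 := mul_inv_cancel₀ (by linarith)
  have hri : r⁻¹ < 1 := inv_lt_one_of_one_lt₀ hr1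
  have hstar : 2 < lamStar := by
    rw [hlamStar]
    nlinarith [mul_pos (sub_pos.2 hr1) (sub_pos.2 hri)]
  obtain ⟨s, hs⟩ : ∃ s, s = lam + ε / 2 := ⟨_, rfl⟩
  obtain ⟨t, ht⟩ : ∃ t, t = lam + ε / 4 := ⟨_, rfl⟩
  have hs2 : 2 < s := by linarith
  have hq : 0 < s ^ 2 - 4 := by nlinarith
  have hq2 := Real.sq_sqrt hq.le
  have hq0 := Real.sqrt_pos.2 hq
  obtain ⟨q, hq'⟩ : ∃ q, q = Real.sqrt (s ^ 2 - 4) := ⟨_, rfl⟩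
  rw [← hq'] at hq2 hq0
  obtain ⟨p, hp⟩ : ∃ p, p = (s - q) / 2 := ⟨_, rfl⟩
  obtain ⟨x, hx⟩ : ∃ x, x = (s + q) / 2 := ⟨_, rfl⟩
  have hpx : p * x = 1 := by rw [hp, hx]; linear_combination -hq2 / 4
  have hsum : s = p + x := by rw [hp, hx]; ring
  have hx0 : 0 < x := by rw [hx]; linarith
  have hp0 : 0 < p := pos_of_mul_pos_left (by linarith) hx0.le
  have hpx' : p < x := by linarith
  have hp1 : p < 1 := by nlinarith
  have hrx : r < x := by
    by_contra! h
    have h1 : 0 ≤ (r - x) * (r - p) := mul_nonneg (by linarith) (by nlinarith)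
    have h2 : r * s ≤ r * (r + r⁻¹) := by rw [hsum]; nlinarith
    have := le_of_mul_le_mul_left h2 (by linarith)
    linarith
  have hx6 : x ^ 2 + 1 ≤ x ^ 6 := by
    have h1 : ρ < x ^ 2 := by nlinarith
    nlinarith [mul_pos (sub_pos.2 h1) (show 0 < x ^ 4 + x ^ 2 * ρ + ρ ^ 2 - 1 by nlinarith)]
  obtain ⟨d, e, h, hd, he⟩ : ∃ d e, Realizable s t d e ∧ 0 < d ∧ e ≤ 0 := by
    rcases lt_or_ge (p ^ 4 + p ^ 2) 1 with hgold | hgold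
    · exact exists_realizable_nonpos_of_sq_add_lt (by linarith) (by linarith) hp0 hpx hsum hp1 hgold
    · exact exists_realizable_nonpos_of_le_sq_add (by linarith) (by linarith) hp0 hpx hsum hp1
        hgold hx6
  obtain ⟨n, G, hG, hl, hu⟩ := h.exists_lam1_mem_Icc (by linarith) hd.le he
  exact ⟨n, G, hG, by linarith, by linarith⟩
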